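/- For smooth zero-mean periodic functions f and g, the trilinear integral satisfies |∫_𝕋 ∂_x f · ∂_x⁴ f · ∂_x³ g dx| ≤ 12 ‖f‖_{Ḣ⁴} (E₄(f,g))^{1/4} (ℰ₀(f,g) ‖f‖_{Ḣ²})^{1/2} (ℰ₀(f,g) ℰ₄(f,g))^{1/4}, where E₄(f,g) = ‖f‖_{Ḣ⁴}² + ‖g‖_{Ḣ⁴}², ℰ₀(f,g) = ‖f‖_{L^∞} + ‖g‖_{L^∞}, and ℰ₄(f,g) = ‖∂_x⁴f‖_{L^∞} + ‖∂_x⁴g‖_{L^∞}. -/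

import Mathlib

lemma aux_cs (a b : ℝ) (hab : a ≤ b) (p q : ℝ → ℝ) (hp : Continuous p) (hq : Continuous q) :
    (∫ x in a..b, p x * q x) ^ 2 ≤ (∫ x in a..b, p x ^ 2) * (∫ x in a..b, q x ^ 2) := by
  have key : ∀ t : ℝ, 0 ≤ (∫ x in a..b, p x ^ 2) * (t * t)
      + (2 * ∫ x in a..b, p x * q x) * t + ∫ x in a..b, q x ^ 2 := by
    intro t
    have h0 : 0 ≤ ∫ x in a..b, (t * p x + q x) ^ 2 :=
      intervalIntegral.integral_nonneg hab (fun x _ => sq_nonneg _)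
    have h1 : (∫ x in a..b, (t * p x + q x) ^ 2) = ∫ x in a..b,
        ((t * t) * p x ^ 2 + (2 * t) * (p x * q x) + q x ^ 2) := by
      congr 1; ext x; ring
    rw [h1, intervalIntegral.integral_add, intervalIntegral.integral_add,
      intervalIntegral.integral_const_mul, intervalIntegral.integral_const_mul] at h0
    · linarith
    all_goals exact Continuous.intervalIntegrable (by fun_prop) _ _
  have := discrim_le_zero key
  unfold discrim at this
  nlinarith

lemma aux_tangent (u u1 u2 : ℝ → ℝ) (h1 : ∀ x, HasDerivAt u (u1 x) x)
    (h2 : ∀ x, HasDerivAt u1 (u2 x) x) (M : ℝ) (hM : ∀ x, |u2 x| ≤ M) (x y : ℝ) :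
    0 ≤ u y - u x - u1 x * (y - x) + M / 2 * (y - x) ^ 2 := by
  have d1 : ∀ z, HasDerivAt (fun z => u z - u x - u1 x * (z - x) + M / 2 * (z - x) ^ 2)
      (u1 z - u1 x + M * (z - x)) z := by
    intro z
    have e := (((h1 z).sub_const (u x)).sub
      (((hasDerivAt_id z).sub_const x).const_mul (u1 x))).add
      ((((hasDerivAt_id z).sub_const x).pow 2).const_mul (M / 2))
    refine e.congr_deriv ?_
    simp
    ring
  have d2 : ∀ z, HasDerivAt (fun z => u1 z - u1 x + M * (z - x)) (u2 z + M) z := by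
    intro z
    have e := ((h2 z).sub_const (u1 x)).add (((hasDerivAt_id z).sub_const x).const_mul M)
    refine e.congr_deriv ?_
    simp
  have mono : Monotone (fun z => u1 z - u1 x + M * (z - x)) :=
    monotone_of_hasDerivAt_nonneg d2 (fun z => by
      have := (abs_le.1 (hM z)).1
      simp only [Pi.zero_apply]; linarith)
  have dif : Differentiable ℝ (fun z => u z - u x - u1 x * (z - x) + M / 2 * (z - x) ^ 2) :=
    fun z => (d1 z).differentiableAt
  rcases le_total x y with h | h
  · have := monotoneOn_of_deriv_nonneg (convex_Ici x) dif.continuous.continuousOn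
      dif.differentiableOn (fun z hz => by
        rw [(d1 z).deriv]
        rw [interior_Ici] at hz
        have := mono (le_of_lt hz)
        simpa using this)
    simpa using this (Set.self_mem_Ici) h h
  · have := antitoneOn_of_deriv_nonpos (convex_Iic x) dif.continuous.continuousOn
      dif.differentiableOn (fun z hz => by
        rw [(d1 z).deriv]
        rw [interior_Iic] at hz
        have := mono (le_of_lt hz)
        simpa using this)
    simpa using this h (Set.self_mem_Iic) h

lemma aux_landau (u u1 u2 : ℝ → ℝ) (h1 : ∀ x, HasDerivAt u (u1 x) x)
    (h2 : ∀ x, HasDerivAt u1 (u2 x) x) (L M : ℝ) (hL : ∀ x, |u x| ≤ L)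
    (hM : ∀ x, |u2 x| ≤ M) (x : ℝ) : u1 x ^ 2 ≤ 4 * L * M := by
  have key : ∀ t : ℝ, 0 ≤ (M / 2) * (t * t) + (- u1 x) * t + 2 * L := by
    intro t
    have := aux_tangent u u1 u2 h1 h2 M hM x (x + t)
    have a := (abs_le.1 (hL x)).1
    have b := (abs_le.1 (hL (x + t))).2
    ring_nf at this ⊢
    linarith
  have := discrim_le_zero key
  unfold discrim at this
  nlinarith

lemma aux_quartic (a b : ℝ) (hab : a ≤ b) (u u1 u2 : ℝ → ℝ) (h1 : ∀ x, HasDerivAt u (u1 x) x)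
    (h2 : ∀ x, HasDerivAt u1 (u2 x) x) (hc : Continuous u2) (e0 : u a = u b) (e1 : u1 a = u1 b)
    (L : ℝ) (hL : ∀ x, |u x| ≤ L) :
    (∫ x in a..b, u1 x ^ 4) ≤ 9 * L ^ 2 * ∫ x in a..b, u2 x ^ 2 := by
  have c0 : Continuous u := continuous_iff_continuousAt.2 fun x => (h1 x).continuousAt
  have c1 : Continuous u1 := continuous_iff_continuousAt.2 fun x => (h2 x).continuousAt
  have parts : (∫ x in a..b, (u1 x ^ 4 + 3 * (u x * u1 x ^ 2 * u2 x))) = 0 := by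
    rw [intervalIntegral.integral_eq_sub_of_hasDerivAt (f := fun x => u x * u1 x ^ 3)]
    · simp [e0, e1]
    · intro x _
      refine ((h1 x).mul ((h2 x).pow 3)).congr_deriv ?_
      simp
      ring
    · exact Continuous.intervalIntegrable (by fun_prop) _ _
  rw [intervalIntegral.integral_add (Continuous.intervalIntegrable (by fun_prop) _ _)
    (Continuous.intervalIntegrable (by fun_prop) _ _),
    intervalIntegral.integral_const_mul] at parts
  have cs := aux_cs a b hab (fun x => u x * u1 x ^ 2) u2 (by fun_prop) hc
  have bd : (∫ x in a..b, (u x * u1 x ^ 2) ^ 2) ≤ L ^ 2 * ∫ x in a..b, u1 x ^ 4 := by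
    rw [← intervalIntegral.integral_const_mul]
    apply intervalIntegral.integral_mono_on hab
      (Continuous.intervalIntegrable (by fun_prop) _ _)
      (Continuous.intervalIntegrable (by fun_prop) _ _)
    intro x _
    have : u x ^ 2 ≤ L ^ 2 := sq_le_sq' (abs_le.1 (hL x)).1 (abs_le.1 (hL x)).2
    have h4 : 0 ≤ u1 x ^ 4 := by positivity
    nlinarith
  have hP : 0 ≤ ∫ x in a..b, u1 x ^ 4 :=
    intervalIntegral.integral_nonneg hab (fun x _ => by positivity)
  have hF : 0 ≤ ∫ x in a..b, u2 x ^ 2 :=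
    intervalIntegral.integral_nonneg hab (fun x _ => by positivity)
  set P := ∫ x in a..b, u1 x ^ 4
  set F := ∫ x in a..b, u2 x ^ 2
  set J := ∫ x in a..b, u x * u1 x ^ 2 * u2 x
  have hPJ : P = -3 * J := by linarith
  rcases hP.eq_or_lt with h | h
  · rw [← h]; positivity
  · have : P * P ≤ P * (9 * L ^ 2 * F) := by
      have := mul_le_mul_of_nonneg_right bd hF
      have e : P * P = 9 * J ^ 2 := by rw [hPJ]; ring
      nlinarith
    exact le_of_mul_le_mul_left this h

lemma aux_hasDeriv (f : ℝ → ℝ) (hf : ContDiff ℝ (⊤ : ℕ∞) f) (n : ℕ) (x : ℝ) :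
    HasDerivAt (iteratedDeriv n f) (iteratedDeriv (n + 1) f x) x := by
  rw [iteratedDeriv_succ]
  exact ((hf.differentiable_iteratedDeriv n (by exact_mod_cast WithTop.coe_lt_top _)) x).hasDerivAt

lemma aux_cont (f : ℝ → ℝ) (hf : ContDiff ℝ (⊤ : ℕ∞) f) (n : ℕ) :
    Continuous (iteratedDeriv n f) :=
  continuous_iff_continuousAt.2 fun x => (aux_hasDeriv f hf n x).continuousAt

lemma aux_per (f : ℝ → ℝ) (c : ℝ) (hp : Function.Periodic f c) (n : ℕ) :
    Function.Periodic (iteratedDeriv n f) c := by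
  intro x
  have h : (fun z => f (z + c)) = f := funext hp
  have := congrFun (iteratedDeriv_comp_add_const n f c) x
  rw [h] at this
  exact this.symm

lemma aux_bdd (u : ℝ → ℝ) (hc : Continuous u) (hp : Function.Periodic u (2 * Real.pi)) (x : ℝ) :
    |u x| ≤ ⨆ x : ℝ, |u x| := by
  have hp' : Function.Periodic (fun x => |u x|) (2 * Real.pi) := fun x => by simp [hp x]
  have : IsCompact (Set.range fun x => |u x|) :=
    hp'.compact_of_continuous Real.two_pi_pos.ne' (by fun_prop)
  exact le_ciSup (f := fun x => |u x|) this.bddAbove x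

lemma aux_M2 (g : ℝ → ℝ) (hg : ContDiff ℝ (⊤ : ℕ∞) g)
    (hp : Function.Periodic g (2 * Real.pi)) :
    (⨆ x : ℝ, |iteratedDeriv 2 g x|) ^ 2 ≤
      256 * (⨆ x : ℝ, |g x|) * (⨆ x : ℝ, |iteratedDeriv 4 g x|) := by
  have b : ∀ n x, |iteratedDeriv n g x| ≤ ⨆ x : ℝ, |iteratedDeriv n g x| := fun n x =>
    aux_bdd _ (aux_cont g hg n) (aux_per g _ hp n) x
  have nn : ∀ n, 0 ≤ ⨆ x : ℝ, |iteratedDeriv n g x| := fun n =>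
    Real.iSup_nonneg fun x => abs_nonneg _
  have step : ∀ n, (⨆ x : ℝ, |iteratedDeriv (n + 1) g x|) ^ 2 ≤
      4 * (⨆ x : ℝ, |iteratedDeriv n g x|) * (⨆ x : ℝ, |iteratedDeriv (n + 2) g x|) := by
    intro n
    have hn : 0 ≤ 4 * (⨆ x : ℝ, |iteratedDeriv n g x|) *
      (⨆ x : ℝ, |iteratedDeriv (n + 2) g x|) :=
      mul_nonneg (mul_nonneg (by norm_num) (nn n)) (nn (n + 2))
    rw [← Real.le_sqrt (nn _) hn]
    apply ciSup_le
    intro x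
    apply Real.abs_le_sqrt
    exact aux_landau _ _ _ (aux_hasDeriv g hg n) (aux_hasDeriv g hg (n + 1)) _ _ (b n)
      (b (n + 2)) x
  have s0 := step 0
  have s1 := step 1
  have s2 := step 2
  have n0 := nn 0
  have n1 := nn 1
  have n2 := nn 2
  have n3 := nn 3
  have n4 := nn 4
  simp only [zero_add, Nat.reduceAdd] at s0 s1 s2
  simp only [iteratedDeriv_zero] at s0 n0
  generalize (⨆ x : ℝ, |g x|) = m0 at *
  generalize (⨆ x : ℝ, |iteratedDeriv 1 g x|) = m1 at *
  generalize (⨆ x : ℝ, |iteratedDeriv 2 g x|) = m2 at *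
  generalize (⨆ x : ℝ, |iteratedDeriv 3 g x|) = m3 at *
  generalize (⨆ x : ℝ, |iteratedDeriv 4 g x|) = m4 at *
  rcases n2.eq_or_lt with h | h
  · rw [← h]; simp; positivity
  · have e : m2 ^ 2 * m2 ^ 2 ≤ m2 ^ 2 * (256 * m0 * m4) := by
      calc m2 ^ 2 * m2 ^ 2 ≤ (4 * m1 * m3) * (4 * m1 * m3) := by gcongr
        _ = 16 * (m1 ^ 2 * m3 ^ 2) := by ring
        _ ≤ 16 * ((4 * m0 * m2) * (4 * m2 * m4)) := by gcongr
        _ = _ := by ring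
    exact le_of_mul_le_mul_left e (by positivity)

/-- Trilinear integral estimate: for smooth zero-mean `2π`-periodic `f, g`,
`|∫ ∂ₓf ∂ₓ⁴f ∂ₓ³g dx| ≤ 12 ‖f‖_{Ḣ⁴} E₄^{1/4} (ℰ₀‖f‖_{Ḣ²})^{1/2} (ℰ₀ℰ₄)^{1/4}`,
where `E₄ = ‖f‖_{Ḣ⁴}² + ‖g‖_{Ḣ⁴}²`, `ℰ₀ = ‖f‖_{L^∞} + ‖g‖_{L^∞}`,
`ℰ₄ = ‖∂ₓ⁴f‖_{L^∞} + ‖∂ₓ⁴g‖_{L^∞}`. -/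
theorem trilinear_integral_estimate (f g : ℝ → ℝ)
    (hfs : ContDiff ℝ (⊤ : ℕ∞) f) (hgs : ContDiff ℝ (⊤ : ℕ∞) g)
    (hfp : Function.Periodic f (2 * Real.pi)) (hgp : Function.Periodic g (2 * Real.pi))
    (hfm : (∫ x in (-Real.pi)..Real.pi, f x) = 0)
    (hgm : (∫ x in (-Real.pi)..Real.pi, g x) = 0) :
    |∫ x in (-Real.pi)..Real.pi, deriv f x * iteratedDeriv 4 f x * iteratedDeriv 3 g x| ≤
      12 * Real.sqrt (∫ x in (-Real.pi)..Real.pi, (iteratedDeriv 4 f x) ^ 2) *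
        ((∫ x in (-Real.pi)..Real.pi, (iteratedDeriv 4 f x) ^ 2) +
          (∫ x in (-Real.pi)..Real.pi, (iteratedDeriv 4 g x) ^ 2)) ^ ((1 : ℝ) / 4) *
        Real.sqrt (((⨆ x : ℝ, |f x|) + (⨆ x : ℝ, |g x|)) *
          Real.sqrt (∫ x in (-Real.pi)..Real.pi, (iteratedDeriv 2 f x) ^ 2)) *
        ((((⨆ x : ℝ, |f x|) + (⨆ x : ℝ, |g x|)) *
          ((⨆ x : ℝ, |iteratedDeriv 4 f x|) + (⨆ x : ℝ, |iteratedDeriv 4 g x|))) ^ ((1 : ℝ) / 4)) := by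
  have hab : -Real.pi ≤ Real.pi := by linarith [Real.pi_pos]
  have ends : ∀ (h : ℝ → ℝ), Function.Periodic h (2 * Real.pi) → ∀ n,
      iteratedDeriv n h (-Real.pi) = iteratedDeriv n h Real.pi := by
    intro h hp n
    have := aux_per h _ hp n (-Real.pi)
    rw [← this]; congr 1; ring
  have cf := aux_cont f hfs
  have cg := aux_cont g hgs
  have hP := aux_quartic _ _ hab _ _ _ (aux_hasDeriv f hfs 0) (aux_hasDeriv f hfs 1) (cf 2)
    (ends f hfp 0) (ends f hfp 1) _ (aux_bdd _ (cf 0) (aux_per f _ hfp 0))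
  have hQ := aux_quartic _ _ hab _ _ _ (aux_hasDeriv g hgs 2) (aux_hasDeriv g hgs 3) (cg 4)
    (ends g hgp 2) (ends g hgp 3) _ (aux_bdd _ (cg 2) (aux_per g _ hgp 2))
  have hM := aux_M2 g hgs hgp
  have cs1 := aux_cs _ _ hab (iteratedDeriv 4 f)
    (fun x => iteratedDeriv 1 f x * iteratedDeriv 3 g x) (cf 4) ((cf 1).mul (cg 3))
  have cs2 := aux_cs _ _ hab (fun x => iteratedDeriv 1 f x ^ 2)
    (fun x => iteratedDeriv 3 g x ^ 2) ((cf 1).pow 2) ((cg 3).pow 2)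
  have eI : (∫ x in (-Real.pi)..Real.pi, deriv f x * iteratedDeriv 4 f x * iteratedDeriv 3 g x)
      = ∫ x in (-Real.pi)..Real.pi,
        iteratedDeriv 4 f x * (iteratedDeriv 1 f x * iteratedDeriv 3 g x) := by
    congr 1; ext x; rw [iteratedDeriv_one]; ring
  rw [eI]
  simp only [mul_pow, ← pow_mul, Nat.reduceMul, zero_add, Nat.reduceAdd] at cs1 cs2 hP hQ
  simp only [iteratedDeriv_zero] at hP
  have nf0 : 0 ≤ ⨆ x : ℝ, |f x| := Real.iSup_nonneg fun x => abs_nonneg _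
  have ng0 : 0 ≤ ⨆ x : ℝ, |g x| := Real.iSup_nonneg fun x => abs_nonneg _
  have nf4 : 0 ≤ ⨆ x : ℝ, |iteratedDeriv 4 f x| := Real.iSup_nonneg fun x => abs_nonneg _
  have ng4 : 0 ≤ ⨆ x : ℝ, |iteratedDeriv 4 g x| := Real.iSup_nonneg fun x => abs_nonneg _
  have nH : 0 ≤ ∫ x in (-Real.pi)..Real.pi, (iteratedDeriv 4 f x) ^ 2 :=
    intervalIntegral.integral_nonneg hab (fun x _ => by positivity)
  have nG : 0 ≤ ∫ x in (-Real.pi)..Real.pi, (iteratedDeriv 4 g x) ^ 2 :=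
    intervalIntegral.integral_nonneg hab (fun x _ => by positivity)
  have nF : 0 ≤ ∫ x in (-Real.pi)..Real.pi, (iteratedDeriv 2 f x) ^ 2 :=
    intervalIntegral.integral_nonneg hab (fun x _ => by positivity)
  have nP : 0 ≤ ∫ x in (-Real.pi)..Real.pi, (iteratedDeriv 1 f x) ^ 4 :=
    intervalIntegral.integral_nonneg hab (fun x _ => by positivity)
  have nQ : 0 ≤ ∫ x in (-Real.pi)..Real.pi, (iteratedDeriv 3 g x) ^ 4 :=
    intervalIntegral.integral_nonneg hab (fun x _ => by positivity)
  generalize (∫ x in (-Real.pi)..Real.pi,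
        iteratedDeriv 4 f x * (iteratedDeriv 1 f x * iteratedDeriv 3 g x)) = I at *
  generalize (∫ x in (-Real.pi)..Real.pi,
        iteratedDeriv 1 f x ^ 2 * iteratedDeriv 3 g x ^ 2) = K at *
  generalize (∫ x in (-Real.pi)..Real.pi, (iteratedDeriv 4 f x) ^ 2) = H at *
  generalize (∫ x in (-Real.pi)..Real.pi, (iteratedDeriv 4 g x) ^ 2) = G at *
  generalize (∫ x in (-Real.pi)..Real.pi, (iteratedDeriv 2 f x) ^ 2) = F at *
  generalize (∫ x in (-Real.pi)..Real.pi, (iteratedDeriv 1 f x) ^ 4) = P at *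
  generalize (∫ x in (-Real.pi)..Real.pi, (iteratedDeriv 3 g x) ^ 4) = Q at *
  generalize (⨆ x : ℝ, |f x|) = a0 at *
  generalize (⨆ x : ℝ, |g x|) = b0 at *
  generalize (⨆ x : ℝ, |iteratedDeriv 4 f x|) = a4 at *
  generalize (⨆ x : ℝ, |iteratedDeriv 4 g x|) = b4 at *
  generalize (⨆ x : ℝ, |iteratedDeriv 2 g x|) = b2 at *
  have r4 : ∀ z : ℝ, 0 ≤ z → (z ^ ((1 : ℝ) / 4)) ^ 4 = z := by
    intro z hz
    rw [← Real.rpow_natCast, ← Real.rpow_mul hz]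
    norm_num
  have s4 : ∀ z : ℝ, 0 ≤ z → (Real.sqrt z) ^ 4 = z ^ 2 := by
    intro z hz
    rw [show (Real.sqrt z) ^ 4 = (Real.sqrt z ^ 2) ^ 2 by ring, Real.sq_sqrt hz]
  refine le_of_pow_le_pow_left₀ (n := 4) (by norm_num) (by positivity) ?_
  rw [mul_pow, mul_pow, mul_pow, mul_pow, r4 _ (by positivity), r4 _ (by positivity),
    s4 _ nH, s4 _ (by positivity), mul_pow, Real.sq_sqrt nF]
  have hI : |I| ^ 4 = (I ^ 2) ^ 2 := by rw [← sq_abs I]; ring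
  rw [hI]
  calc (I ^ 2) ^ 2 ≤ (H * K) ^ 2 := by gcongr
    _ = H ^ 2 * K ^ 2 := by ring
    _ ≤ H ^ 2 * (P * Q) := by gcongr
    _ ≤ H ^ 2 * ((9 * a0 ^ 2 * F) * (9 * b2 ^ 2 * G)) := by gcongr
    _ ≤ H ^ 2 * ((9 * a0 ^ 2 * F) * (9 * (256 * b0 * b4) * G)) := by gcongr
    _ = 12 ^ 4 * H ^ 2 * G * (a0 ^ 2 * F) * (b0 * b4) := by ring
    _ ≤ 12 ^ 4 * H ^ 2 * (H + G) * ((a0 + b0) ^ 2 * F) * ((a0 + b0) * (a4 + b4)) := by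
      gcongr <;> linarith
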